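/- Consider the MMAHH with acceptance operators OI and OW on f = OneMax, with p, q ∈ (0,1), started from an arbitrary x_0 ∈ L_{n−k} and s_0 = OW, where k ∈ [0..n]. For h ∈ [0..n], the probability Pr[y_{T_s^{(1)}} ≥ n − h] equals 1 if k ≤ h, and equals (1/(1−q)) · (Γ(k+1)·Γ(n·q/(1−q) + h + 1)) / (Γ(h+1)·Γ(n·q/(1−q) + k + 1)) if k > h. -/

import Mathlib

open MeasureTheory
open scoped ENNReal NNReal

namespace MMAHHStmt

/-- The two acceptance operators. -/
inductive Op : Type
  | OI : Op
  | OW : Op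
  deriving DecidableEq

instance : MeasurableSpace Op := ⊤

/-- Search points: bit-strings of length `n`. -/
abbrev Point (n : ℕ) := Fin n → Bool

/-- The number of one-bits of a bit-string. -/
def ones {n : ℕ} (x : Point n) : ℕ := (Finset.univ.filter fun i => x i = true).card

/-- The all-ones string, the global optimum of all benchmarks considered. -/
def optimum (n : ℕ) : Point n := fun _ => true

/-- Flipping the bit in position `v`. -/
def flipBit {n : ℕ} (x : Point n) (v : Fin n) : Point n := Function.update x v (!(x v))

open Classical in
/-- The search point obtained from `x` by proposing to flip bit `v` and applying the
acceptance operator `op` for the objective function `f`. -/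
noncomputable def movedPoint {n : ℕ} (f : Point n → ℝ) (op : Op) (x : Point n) (v : Fin n) :
    Point n :=
  match op with
  | Op.OI => if f x < f (flipBit x v) then flipBit x v else x
  | Op.OW => if f (flipBit x v) < f x then flipBit x v else x

open Classical in
/-- One-step transition probability of the search point under acceptance operator `op`:
a uniformly random bit is flipped and the move is accepted or rejected according to `op`. -/
noncomputable def moveProb {n : ℕ} (f : Point n → ℝ) (op : Op) (x x' : Point n) : ℝ≥0∞ :=
  ((Finset.univ.filter fun v => movedPoint f op x v = x').card : ℝ≥0∞) / n

/-- Transition probabilities of the two-state Markov chain on the acceptance operators. -/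
noncomputable def switchProb (p q : ℝ) : Op → Op → ℝ≥0∞
  | Op.OI, Op.OI => ENNReal.ofReal (1 - p)
  | Op.OI, Op.OW => ENNReal.ofReal p
  | Op.OW, Op.OI => ENNReal.ofReal q
  | Op.OW, Op.OW => ENNReal.ofReal (1 - q)

/-- One-step transition probabilities of the MMAHH on the state space
`Point n × Op`: the search point moves according to the current acceptance operator, and,
independently, the operator switches according to the two-state Markov chain. -/
noncomputable def mmahhTrans {n : ℕ} (f : Point n → ℝ) (p q : ℝ) :
    Point n × Op → Point n × Op → ℝ≥0∞ :=
  fun s s' => moveProb f s.2 s.1 s'.1 * switchProb p q s.2 s'.2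

/-- `X` is (a version of) the MMAHH Markov chain with objective function `f` and switching
probabilities `p` and `q`, under the measure `μ`: each `X t` is measurable, and conditionally
on any history, the next state is distributed according to `mmahhTrans`. -/
def IsMMAHH {n : ℕ} {Ω : Type*} [MeasurableSpace Ω] (μ : Measure Ω)
    (X : ℕ → Ω → Point n × Op) (f : Point n → ℝ) (p q : ℝ) : Prop :=
  (∀ t, Measurable (X t)) ∧
  ∀ (t : ℕ) (σ : ℕ → Point n × Op) (s' : Point n × Op),
    μ {ω | (∀ i ≤ t, X i ω = σ i) ∧ X (t + 1) ω = s'}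
      = μ {ω | ∀ i ≤ t, X i ω = σ i} * mmahhTrans f p q (σ t) s'

/-- The runtime: the first hitting time of the global optimum, as an extended natural number
(`⊤` if the optimum is never reached). -/
noncomputable def hitTime {n : ℕ} {Ω : Type*} (X : ℕ → Ω → Point n × Op) (ω : Ω) : ℕ∞ :=
  ⨅ t ∈ {t : ℕ | (X t ω).1 = optimum n}, (t : ℕ∞)

/-- The `k`-th switching time between the two acceptance operators (with junk value given by
`Nat.sInf ∅ = 0` on the probability-zero event that no further switch occurs). -/
noncomputable def switchTime {n : ℕ} {Ω : Type*} (X : ℕ → Ω → Point n × Op) : ℕ → Ω → ℕ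
  | 0, _ => 0
  | k + 1, ω =>
      sInf {t : ℕ | switchTime X k ω ≤ t ∧ (X t ω).2 ≠ (X (switchTime X k ω) ω).2}

/-- The OneMax benchmark. -/
noncomputable def OneMax (n : ℕ) (x : Point n) : ℝ := (ones x : ℝ)

instance opFintype : Fintype Op := ⟨{Op.OI, Op.OW}, fun x => by cases x <;> simp⟩

instance opSing : MeasurableSingletonClass Op := ⟨fun _ => trivial⟩

/-- The event that the first phase is OW up to time `t` and the point at time `t` is `x`. -/
def evB {n : ℕ} {Ω : Type} (X : ℕ → Ω → Point n × Op) (t : ℕ) (x : Point n) : Set Ω :=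
  {ω | (∀ i ≤ t, (X i ω).2 = Op.OW) ∧ (X t ω).1 = x}

lemma measurable_event {n : ℕ} {Ω : Type} [MeasurableSpace Ω] {X : ℕ → Ω → Point n × Op}
    (hX : ∀ t, Measurable (X t)) (t : ℕ) (S : Set (Point n × Op)) :
    MeasurableSet {ω | X t ω ∈ S} := hX t (Set.toFinite S).measurableSet

lemma markov_event {n : ℕ} {Ω : Type} [MeasurableSpace Ω] {μ : Measure Ω}
    {X : ℕ → Ω → Point n × Op} {f : Point n → ℝ} {p q : ℝ} (hc : IsMMAHH μ X f p q)
    (t : ℕ) (x : Point n) (s' : Point n × Op) :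
    μ (evB X t x ∩ {ω | X (t + 1) ω = s'}) = μ (evB X t x) * mmahhTrans f p q (x, Op.OW) s' := by
  classical
  obtain ⟨hX, hM⟩ := hc
  let H : Ω → (Fin (t + 1) → Point n × Op) := fun ω i => X i ω
  have hH : Measurable H := measurable_pi_lambda _ fun i => hX i
  let S : Finset (Fin (t + 1) → Point n × Op) :=
    Finset.univ.filter fun τ => (∀ i, (τ i).2 = Op.OW) ∧ (τ (Fin.last t)).1 = x
  have hS : evB X t x = H ⁻¹' (S : Set _) := by
    ext ω
    simp only [evB, Set.mem_ofPred_eq, Set.mem_preimage, S, Finset.coe_filter, Finset.mem_univ,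
      true_and, H, Fin.val_last]
    constructor
    · rintro ⟨h1, h2⟩
      exact ⟨fun i => h1 i (by omega), h2⟩
    · rintro ⟨h1, h2⟩
      exact ⟨fun i hi => h1 ⟨i, by omega⟩, h2⟩
  have hE : MeasurableSet {ω | X (t + 1) ω = s'} := measurable_event hX (t + 1) {s'}
  have hms : ∀ y, MeasurableSet (H ⁻¹' {y}) := fun y => hH (measurableSet_singleton y)
  have hBm : MeasurableSet (evB X t x) := hS ▸ hH (Set.toFinite _).measurableSet
  rw [← Measure.restrict_apply hBm, hS,
    ← sum_measure_preimage_singleton S (fun y _ => hms y),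
    ← sum_measure_preimage_singleton S (fun y _ => hms y), Finset.sum_mul]
  refine Finset.sum_congr rfl fun τ hτ => ?_
  rw [Measure.restrict_apply (hms τ)]
  have hτ' : (∀ i, (τ i).2 = Op.OW) ∧ (τ (Fin.last t)).1 = x := by simpa [S] using hτ
  let σ : ℕ → Point n × Op := fun i => if hi : i < t + 1 then τ ⟨i, hi⟩ else τ 0
  have hcyl : H ⁻¹' {τ} = {ω | ∀ i ≤ t, X i ω = σ i} := by
    ext ω
    simp only [Set.mem_preimage, Set.mem_singleton_iff, Set.mem_ofPred_eq, H, funext_iff, σ]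
    constructor
    · intro h i hi
      rw [dif_pos (by omega)]
      exact h ⟨i, by omega⟩
    · intro h i
      have := h i (by omega)
      rwa [dif_pos i.2] at this
  have hσt : σ t = (x, Op.OW) := by
    simp only [σ]
    rw [dif_pos (by omega)]
    exact Prod.ext hτ'.2 (hτ'.1 _)
  have := hM t σ s'
  rw [hσt] at this
  rw [hcyl, ← this]
  rfl

lemma fiber_sum {n : ℕ} {Ω : Type} [MeasurableSpace Ω] {μ : Measure Ω}
    {X : ℕ → Ω → Point n × Op} (hX : ∀ t, Measurable (X t)) (t : ℕ) {E : Set Ω}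
    (hE : MeasurableSet E) :
    μ E = ∑ x : Point n, μ ({ω | (X t ω).1 = x} ∩ E) := by
  have hm : Measurable fun ω => (X t ω).1 := measurable_fst.comp (hX t)
  have h := sum_measure_preimage_singleton (μ := μ.restrict E) (f := fun ω => (X t ω).1)
    Finset.univ (fun y _ => hm (measurableSet_singleton y))
  simp only [Finset.coe_univ, Set.preimage_univ, Measure.restrict_apply_univ] at h
  rw [← h]
  refine Finset.sum_congr rfl fun x _ => ?_
  rw [Measure.restrict_apply (hm (measurableSet_singleton x))]
  rfl

/-- The phase switches at time `t+1`, at a point with at most `h` ones. -/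
def evE {n : ℕ} {Ω : Type} (X : ℕ → Ω → Point n × Op) (h t : ℕ) : Set Ω :=
  {ω | (∀ i ≤ t, (X i ω).2 = Op.OW) ∧ (X (t + 1) ω).2 = Op.OI ∧ ones (X (t + 1) ω).1 ≤ h}

lemma meas_OW {n : ℕ} {Ω : Type} [MeasurableSpace Ω]
    {X : ℕ → Ω → Point n × Op} (hX : ∀ t, Measurable (X t)) (t : ℕ) :
    MeasurableSet {ω | ∀ i ≤ t, (X i ω).2 = Op.OW} := by
  simp only [Set.ofPred_forall]
  exact MeasurableSet.iInter fun i => MeasurableSet.iInter fun _ =>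
    measurable_event hX i {s | s.2 = Op.OW}

lemma meas_E {n : ℕ} {Ω : Type} [MeasurableSpace Ω]
    {X : ℕ → Ω → Point n × Op} (hX : ∀ t, Measurable (X t)) (h t : ℕ) :
    MeasurableSet (evE X h t) :=
  (meas_OW hX t).inter (measurable_event hX (t + 1) {s | s.2 = Op.OI ∧ ones s.1 ≤ h})

lemma meas_B {n : ℕ} {Ω : Type} [MeasurableSpace Ω]
    {X : ℕ → Ω → Point n × Op} (hX : ∀ t, Measurable (X t)) (t : ℕ) (x : Point n) :
    MeasurableSet (evB X t x) :=
  (meas_OW hX t).inter (measurable_event hX t {s | s.1 = x})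

lemma step_B {n : ℕ} {Ω : Type} [MeasurableSpace Ω] {μ : Measure Ω}
    {X : ℕ → Ω → Point n × Op} {f : Point n → ℝ} {p q : ℝ} (hc : IsMMAHH μ X f p q)
    (t : ℕ) (x' : Point n) :
    μ (evB X (t + 1) x') =
      ∑ x, μ (evB X t x) * (moveProb f Op.OW x x' * ENNReal.ofReal (1 - q)) := by
  rw [fiber_sum hc.1 t (meas_B hc.1 (t + 1) x')]
  refine Finset.sum_congr rfl fun x _ => ?_
  have := markov_event hc t x (x', Op.OW)
  simp only [mmahhTrans, switchProb] at this
  rw [← this]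
  congr 1
  ext ω
  simp only [evB, Set.mem_inter_iff, Set.mem_ofPred_eq, Prod.ext_iff]
  constructor
  · rintro ⟨h1, h2, h3⟩
    exact ⟨⟨fun i hi => h2 i (by omega), h1⟩, h3, h2 _ le_rfl⟩
  · rintro ⟨⟨h1, h2⟩, h3, h4⟩
    refine ⟨h2, fun i hi => ?_, h3⟩
    rcases Nat.lt_or_ge i (t + 1) with h | h
    · exact h1 i (by omega)
    · obtain rfl : i = t + 1 := by omega
      exact h4

lemma step_E {n : ℕ} {Ω : Type} [MeasurableSpace Ω] {μ : Measure Ω}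
    {X : ℕ → Ω → Point n × Op} {f : Point n → ℝ} {p q : ℝ} (hc : IsMMAHH μ X f p q)
    (h t : ℕ) :
    μ (evE X h t) =
      ∑ x, μ (evB X t x) *
        ∑ x', moveProb f Op.OW x x' * (ENNReal.ofReal q * if ones x' ≤ h then 1 else 0) := by
  rw [fiber_sum hc.1 t (meas_E hc.1 h t)]
  refine Finset.sum_congr rfl fun x _ => ?_
  have hm : MeasurableSet ({ω | (X t ω).1 = x} ∩ evE X h t) :=
    (measurable_event hc.1 t {s | s.1 = x}).inter (meas_E hc.1 h t)
  rw [fiber_sum hc.1 (t + 1) hm, Finset.mul_sum]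
  refine Finset.sum_congr rfl fun x' _ => ?_
  have := markov_event hc t x (x', Op.OI)
  simp only [mmahhTrans, switchProb] at this
  by_cases hx : ones x' ≤ h
  · rw [if_pos hx, mul_one, ← this]
    congr 1
    ext ω
    simp only [evB, evE, Set.mem_inter_iff, Set.mem_ofPred_eq, Prod.ext_iff]
    constructor
    · rintro ⟨h1, h2, h3, h4, h5⟩
      exact ⟨⟨h3, h2⟩, h1, h4⟩
    · rintro ⟨⟨h1, h2⟩, h3, h4⟩
      exact ⟨h3, h2, h1, h4, by rw [h3]; exact hx⟩
  · rw [if_neg hx]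
    simp only [mul_zero]
    convert measure_empty (μ := μ)
    ext ω
    simp only [evE, Set.mem_inter_iff, Set.mem_ofPred_eq, Set.mem_empty_iff_false, iff_false]
    rintro ⟨h1, h2, h3, h4, h5⟩
    rw [h1] at h5
    exact hx h5

lemma sum_moveProb {n : ℕ} (f : Point n → ℝ) (op : Op) (x : Point n) (F : Point n → ℝ≥0∞) :
    ∑ x', moveProb f op x x' * F x' = (∑ v, F (movedPoint f op x v)) / n := by
  classical
  simp only [moveProb, div_eq_mul_inv]
  rw [← Finset.sum_fiberwise (s := Finset.univ) (g := fun v => movedPoint f op x v),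
    Finset.sum_mul]
  refine Finset.sum_congr rfl fun x' _ => ?_
  rw [Finset.sum_congr rfl (g := fun _ => F x')
    (fun v hv => by rw [(Finset.mem_filter.1 hv).2])]
  rw [Finset.sum_const, nsmul_eq_mul, mul_right_comm]

lemma ones_flip_true {n : ℕ} (x : Point n) (v : Fin n) (hv : x v = true) :
    ones (flipBit x v) + 1 = ones x := by
  unfold ones flipBit
  have h1 : (Finset.univ.filter fun i => Function.update x v (!(x v)) i = true) =
      (Finset.univ.filter fun i => x i = true).erase v := by
    ext i
    by_cases hi : i = v
    · subst hi; simp [hv]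
    · simp [hi]
  rw [h1, Finset.card_erase_add_one (by simp [hv])]

lemma ones_flip_false {n : ℕ} (x : Point n) (v : Fin n) (hv : x v = false) :
    ones (flipBit x v) = ones x + 1 := by
  unfold ones flipBit
  have h1 : (Finset.univ.filter fun i => Function.update x v (!(x v)) i = true) =
      insert v (Finset.univ.filter fun i => x i = true) := by
    ext i
    by_cases hi : i = v
    · subst hi; simp [hv]
    · simp [hi]
  rw [h1, Finset.card_insert_of_notMem (by simp [hv])]

lemma ones_le {n : ℕ} (x : Point n) : ones x ≤ n := by
  unfold ones
  exact (Finset.card_le_univ _).trans (by simp)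

lemma ones_moved {n : ℕ} (x : Point n) (v : Fin n) :
    ones (movedPoint (OneMax n) Op.OW x v) = if x v = true then ones x - 1 else ones x := by
  unfold movedPoint OneMax
  cases hv : x v with
  | true =>
    have := ones_flip_true x v hv
    have h2 : ((ones (flipBit x v) : ℕ) : ℝ) < ones x := by exact_mod_cast (by omega)
    simp only [h2, if_true]
    omega
  | false =>
    have := ones_flip_false x v hv
    have h2 : ¬ ((ones (flipBit x v) : ℕ) : ℝ) < ones x := by
      rw [Nat.cast_lt]; omega
    simp [h2]

lemma sum_moveProb_ones {n : ℕ} (x : Point n) (F : ℕ → ℝ≥0∞) :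
    ∑ x', moveProb (OneMax n) Op.OW x x' * F (ones x') =
      ((ones x : ℝ≥0∞) * F (ones x - 1) + ((n - ones x : ℕ) : ℝ≥0∞) * F (ones x)) / n := by
  rw [sum_moveProb]
  congr 1
  simp only [ones_moved, apply_ite F]
  rw [Finset.sum_ite, Finset.sum_const, Finset.sum_const, nsmul_eq_mul, nsmul_eq_mul]
  congr 3
  have := Finset.card_filter_add_card_filter_not (s := (Finset.univ : Finset (Fin n)))
    (fun i => x i = true)
  simp only [Finset.card_univ, Fintype.card_fin] at this
  unfold ones
  omega

/-- The success probability as function of the number of one-bits. -/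
noncomputable def succA (n h : ℕ) (q : ℝ) (i : ℕ) : ℝ :=
  if i ≤ h then 1 else (1 / (1 - q)) *
        (Real.Gamma ((i : ℝ) + 1) * Real.Gamma ((n : ℝ) * q / (1 - q) + (h : ℝ) + 1)) /
        (Real.Gamma ((h : ℝ) + 1) * Real.Gamma ((n : ℝ) * q / (1 - q) + (i : ℝ) + 1))

lemma succA_nonneg (n h : ℕ) (q : ℝ) (hq0 : 0 < q) (hq1 : q < 1) (i : ℕ) :
    0 ≤ succA n h q i := by
  unfold succA
  have hq : 0 < 1 - q := by linarith
  have hc : 0 ≤ (n : ℝ) * q / (1 - q) := by positivity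
  split_ifs
  · exact zero_le_one
  · have h1 := Real.Gamma_pos_of_pos (s := (i : ℝ) + 1) (by positivity)
    have h2 := Real.Gamma_pos_of_pos (s := (h : ℝ) + 1) (by positivity)
    have h3 := Real.Gamma_pos_of_pos (s := (n : ℝ) * q / (1 - q) + (h : ℝ) + 1) (by positivity)
    have h4 := Real.Gamma_pos_of_pos (s := (n : ℝ) * q / (1 - q) + (i : ℝ) + 1) (by positivity)
    positivity

lemma succA_rec (n h : ℕ) (q : ℝ) (hq0 : 0 < q) (hq1 : q < 1) (i : ℕ) (hi : i ≤ n) :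
    (i : ℝ) * ((1 - q) * succA n h q (i - 1) + q * if i - 1 ≤ h then 1 else 0) +
      ((n - i : ℕ) : ℝ) * ((1 - q) * succA n h q i + q * if i ≤ h then 1 else 0) =
      n * succA n h q i := by
  rw [Nat.cast_sub hi]
  by_cases hih : i ≤ h
  · have : i - 1 ≤ h := by omega
    simp only [succA, hih, this, if_true]
    ring
  · obtain ⟨j, rfl⟩ : ∃ j, i = j + 1 := ⟨i - 1, by omega⟩
    have hq : 0 < 1 - q := by linarith
    have hq' : 1 - q ≠ 0 := hq.ne'
    have hc : 0 ≤ (n : ℝ) * q / (1 - q) := by positivity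
    have hcq : (n : ℝ) * q / (1 - q) * (1 - q) = n * q := by field_simp
    simp only [Nat.add_sub_cancel, hih, if_false]
    have h2 := Real.Gamma_pos_of_pos (s := (h : ℝ) + 1) (by positivity)
    have h3 := Real.Gamma_pos_of_pos (s := (n : ℝ) * q / (1 - q) + (h : ℝ) + 1) (by positivity)
    have h4 := Real.Gamma_pos_of_pos (s := (n : ℝ) * q / (1 - q) + (j : ℝ) + 1) (by positivity)
    have e1 : Real.Gamma ((j + 1 : ℕ) + 1 : ℝ) = (j + 1) * Real.Gamma ((j : ℝ) + 1) := by
      push_cast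
      exact Real.Gamma_add_one (by positivity)
    have e2 : Real.Gamma ((n : ℝ) * q / (1 - q) + (j + 1 : ℕ) + 1 : ℝ) =
        ((n : ℝ) * q / (1 - q) + j + 1) * Real.Gamma ((n : ℝ) * q / (1 - q) + j + 1) := by
      rw [← Real.Gamma_add_one (by positivity)]
      push_cast
      congr 1
      ring
    have hA : succA n h q (j + 1) = (1 / (1 - q)) *
        (((j + 1) * Real.Gamma ((j : ℝ) + 1)) * Real.Gamma ((n : ℝ) * q / (1 - q) + (h : ℝ) + 1)) /
        (Real.Gamma ((h : ℝ) + 1) *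
        (((n : ℝ) * q / (1 - q) + j + 1) * Real.Gamma ((n : ℝ) * q / (1 - q) + j + 1))) := by
      unfold succA
      rw [if_neg hih, e1, e2]
    have key : ∀ B : ℝ, succA n h q (j + 1) * ((n : ℝ) * q / (1 - q) + j + 1) = (j + 1) * B →
        ((j + 1 : ℕ) : ℝ) * ((1 - q) * B) + (n - (j + 1 : ℕ)) *
          ((1 - q) * succA n h q (j + 1) + q * 0) = n * succA n h q (j + 1) := by
      intro B hB
      push_cast
      linear_combination (-(1 - q)) * hB + succA n h q (j + 1) * hcq
    have hpos : 0 < (n : ℝ) * q / (1 - q) + j + 1 := by positivity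
    by_cases hj : j ≤ h
    · obtain rfl : j = h := by omega
      have hB := key (1 / (1 - q)) (by
        rw [hA]; clear hcq e1 e2 hA key
        generalize (n : ℝ) * q / (1 - q) = c at *
        field_simp)
      rw [← hB]
      simp only [succA, le_refl, if_true]
      congr 2
      field_simp
      ring
    · have hB := key (succA n h q j) (by
        rw [hA]; unfold succA; rw [if_neg hj]; clear hcq e1 e2 hA key
        generalize (n : ℝ) * q / (1 - q) = c at *
        field_simp)
      simp only [hj, if_false]
      rw [← hB]
      ring

lemma harm (n h : ℕ) (hn : 2 ≤ n) (q : ℝ) (hq0 : 0 < q) (hq1 : q < 1) (x : Point n) :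
    ∑ x', moveProb (OneMax n) Op.OW x x' *
      (ENNReal.ofReal (1 - q) * ENNReal.ofReal (succA n h q (ones x')) +
        ENNReal.ofReal q * if ones x' ≤ h then 1 else 0) =
    ENNReal.ofReal (succA n h q (ones x)) := by
  have hq : 0 ≤ 1 - q := by linarith
  have conv : ∀ i : ℕ, (ENNReal.ofReal (1 - q) * ENNReal.ofReal (succA n h q i) +
        ENNReal.ofReal q * if i ≤ h then 1 else 0) =
      ENNReal.ofReal ((1 - q) * succA n h q i + q * if i ≤ h then 1 else 0) := by
    intro i
    have := succA_nonneg n h q hq0 hq1 i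
    rw [ENNReal.ofReal_add (by positivity) (by positivity), ENNReal.ofReal_mul hq,
      ENNReal.ofReal_mul hq0.le]
    congr 2
    split_ifs <;> simp
  have nn : ∀ i : ℕ, 0 ≤ ((1 - q) * succA n h q i + q * if i ≤ h then (1 : ℝ) else 0) := by
    intro i
    have := succA_nonneg n h q hq0 hq1 i
    positivity
  rw [sum_moveProb_ones x (fun i => ENNReal.ofReal (1 - q) * ENNReal.ofReal (succA n h q i) +
        ENNReal.ofReal q * if i ≤ h then 1 else 0)]
  simp only [conv]
  rw [← ENNReal.ofReal_natCast (ones x), ← ENNReal.ofReal_natCast (n - ones x),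
    ← ENNReal.ofReal_natCast n, ← ENNReal.ofReal_mul (by positivity),
    ← ENNReal.ofReal_mul (by positivity), ← ENNReal.ofReal_add
      (mul_nonneg (by positivity) (nn _)) (mul_nonneg (by positivity) (nn _)),
    succA_rec n h q hq0 hq1 (ones x) (ones_le x), ENNReal.ofReal_mul (by positivity)]
  rw [mul_comm]
  refine ENNReal.mul_div_cancel_right ?_ ENNReal.ofReal_ne_top
  simp
  omega

lemma sum_B {n : ℕ} (hn : 2 ≤ n) {Ω : Type} [MeasurableSpace Ω] {μ : Measure Ω}
    [IsProbabilityMeasure μ]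
    {X : ℕ → Ω → Point n × Op} {p q : ℝ} (hc : IsMMAHH μ X (OneMax n) p q) (t : ℕ) :
    ∑ x, μ (evB X t x) ≤ ENNReal.ofReal (1 - q) ^ t := by
  induction t with
  | zero =>
    rw [pow_zero]
    have h1 := fiber_sum (μ := μ) hc.1 0 (meas_OW hc.1 0)
    refine le_trans (le_of_eq ?_) (prob_le_one (μ := μ) (s := {ω | ∀ i ≤ 0, (X i ω).2 = Op.OW}))
    rw [h1]
    refine Finset.sum_congr rfl fun x _ => ?_
    rw [Set.inter_comm]
    rfl
  | succ t ih =>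
    rw [pow_succ]
    refine le_trans (le_of_eq ?_) (mul_le_mul_left ih _)
    simp only [step_B hc]
    rw [Finset.sum_comm, Finset.sum_mul]
    refine Finset.sum_congr rfl fun x _ => ?_
    rw [← Finset.mul_sum, ← Finset.sum_mul]
    have := sum_moveProb (OneMax n) Op.OW x (fun _ => 1)
    simp only [mul_one, Finset.sum_const, Finset.card_univ, Fintype.card_fin, nsmul_eq_mul] at this
    rw [this, ENNReal.div_self (by simp; omega) (by simp), one_mul]

lemma balance {n : ℕ} (hn : 2 ≤ n) {Ω : Type} [MeasurableSpace Ω] {μ : Measure Ω}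
    {X : ℕ → Ω → Point n × Op} {p q : ℝ} (hq0 : 0 < q) (hq1 : q < 1)
    (hc : IsMMAHH μ X (OneMax n) p q) (h t : ℕ) :
    ∑ x, μ (evB X t x) * ENNReal.ofReal (succA n h q (ones x)) =
      μ (evE X h t) + ∑ x, μ (evB X (t + 1) x) * ENNReal.ofReal (succA n h q (ones x)) := by
  simp only [step_B hc, step_E hc, Finset.sum_mul]
  rw [Finset.sum_comm (γ := Point n), ← Finset.sum_add_distrib]
  refine Finset.sum_congr rfl fun x _ => ?_
  rw [← harm n h hn q hq0 hq1 x]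
  simp only [mul_add, Finset.sum_add_distrib, mul_assoc]
  rw [add_comm]
  simp only [Finset.mul_sum]

lemma partial_sum {n : ℕ} (hn : 2 ≤ n) {Ω : Type} [MeasurableSpace Ω] {μ : Measure Ω}
    {X : ℕ → Ω → Point n × Op} {p q : ℝ} (hq0 : 0 < q) (hq1 : q < 1)
    (hc : IsMMAHH μ X (OneMax n) p q) (h t : ℕ) :
    ∑ x, μ (evB X 0 x) * ENNReal.ofReal (succA n h q (ones x)) =
      ∑ s ∈ Finset.range t, μ (evE X h s) +
        ∑ x, μ (evB X t x) * ENNReal.ofReal (succA n h q (ones x)) := by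
  induction t with
  | zero => simp
  | succ t ih => rw [ih, balance hn hq0 hq1 hc, Finset.sum_range_succ, add_assoc]

lemma tsum_E {n : ℕ} (hn : 2 ≤ n) {Ω : Type} [MeasurableSpace Ω] {μ : Measure Ω}
    [IsProbabilityMeasure μ]
    {X : ℕ → Ω → Point n × Op} {p q : ℝ} (hq0 : 0 < q) (hq1 : q < 1)
    (hc : IsMMAHH μ X (OneMax n) p q) (h : ℕ) :
    ∑' s, μ (evE X h s) = ∑ x, μ (evB X 0 x) * ENNReal.ofReal (succA n h q (ones x)) := by
  have h1 := ENNReal.tendsto_nat_tsum (fun s => μ (evE X h s))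
  set C : ℝ≥0∞ := ∑ x : Point n, ENNReal.ofReal (succA n h q (ones x)) with hC
  have hCtop : C ≠ ⊤ := ENNReal.sum_ne_top.2 fun _ _ => ENNReal.ofReal_ne_top
  have hr : ENNReal.ofReal (1 - q) < 1 := by
    rw [ENNReal.ofReal_lt_one]; linarith
  have h2 : Filter.Tendsto (fun t => ∑ x, μ (evB X t x) * ENNReal.ofReal (succA n h q (ones x)))
      Filter.atTop (nhds 0) := by
    have h3 : Filter.Tendsto (fun t => ENNReal.ofReal (1 - q) ^ t * C) Filter.atTop (nhds 0) := by
      have := ENNReal.Tendsto.mul_const (ENNReal.tendsto_pow_atTop_nhds_zero_of_lt_one hr)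
        (Or.inr hCtop)
      simpa using this
    refine tendsto_of_tendsto_of_tendsto_of_le_of_le tendsto_const_nhds h3 (fun _ => zero_le) ?_
    intro t
    refine le_trans ?_ (mul_le_mul_left (sum_B hn hc t) C)
    rw [Finset.sum_mul]
    refine Finset.sum_le_sum fun x _ => ?_
    gcongr
    exact Finset.single_le_sum (f := fun x : Point n => ENNReal.ofReal (succA n h q (ones x)))
      (fun _ _ => zero_le) (Finset.mem_univ x)
  have h4 := h1.add h2
  simp only [← partial_sum hn hq0 hq1 hc h, add_zero] at h4
  exact tendsto_nhds_unique h4 tendsto_const_nhds |>.symm ▸ rfl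

lemma switch_of_E {n : ℕ} {Ω : Type} (X : ℕ → Ω → Point n × Op) (h t : ℕ) (ω : Ω)
    (hω : ω ∈ evE X h t) : switchTime X 1 ω = t + 1 := by
  obtain ⟨h1, h2, h3⟩ := hω
  simp only [switchTime]
  have h0 := h1 0 (Nat.zero_le _)
  apply le_antisymm
  · apply Nat.sInf_le
    refine ⟨Nat.zero_le _, ?_⟩
    rw [h0, h2]; simp
  · apply le_csInf
    · exact ⟨t + 1, Nat.zero_le _, by rw [h0, h2]; simp⟩
    · rintro s ⟨-, hs⟩
      by_contra hlt
      exact hs (by rw [h0, h1 s (by omega)])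

lemma event_cover {n : ℕ} {Ω : Type} (X : ℕ → Ω → Point n × Op) (h : ℕ) (ω : Ω)
    (h0 : (X 0 ω).2 = Op.OW) (hh : h < ones (X 0 ω).1)
    (hω : ones (X (switchTime X 1 ω) ω).1 ≤ h) : ∃ t, ω ∈ evE X h t := by
  have hne : {t : ℕ | 0 ≤ t ∧ (X t ω).2 ≠ (X 0 ω).2}.Nonempty := by
    by_contra hemp
    rw [Set.not_nonempty_iff_eq_empty] at hemp
    simp only [switchTime, hemp, Nat.sInf_empty] at hω
    omega
  have hmem := Nat.sInf_mem hne
  have hlt : ∀ s < switchTime X 1 ω, (X s ω).2 = Op.OW := by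
    intro s hs
    have := Nat.notMem_of_lt_sInf (m := s) (s := {t : ℕ | 0 ≤ t ∧ (X t ω).2 ≠ (X 0 ω).2}) hs
    simp only [Set.mem_ofPred_eq, Nat.zero_le, true_and, not_not] at this
    rw [this, h0]
  have hT : (X (switchTime X 1 ω) ω).2 ≠ Op.OW := by
    rw [← h0]; exact hmem.2
  obtain ⟨t, ht⟩ : ∃ t, switchTime X 1 ω = t + 1 := by
    rcases Nat.eq_zero_or_pos (switchTime X 1 ω) with h' | h'
    · rw [h'] at hT; exact absurd h0 hT
    · exact ⟨_, (Nat.succ_pred_eq_of_pos h').symm⟩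
  rw [ht] at hlt hT hω
  refine ⟨t, fun i hi => hlt i (by omega), ?_, hω⟩
  cases hx : (X (t + 1) ω).2 with
  | OI => rfl
  | OW => exact absurd hx hT

lemma ev_prob {n : ℕ} (hn : 2 ≤ n) {Ω : Type} [MeasurableSpace Ω] {μ : Measure Ω}
    [IsProbabilityMeasure μ]
    {X : ℕ → Ω → Point n × Op} {p q : ℝ} (hq0 : 0 < q) (hq1 : q < 1)
    (hc : IsMMAHH μ X (OneMax n) p q) (h : ℕ) (x0 : Point n)
    (hinit : μ {ω | X 0 ω = (x0, Op.OW)} = 1) :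
    μ (⋃ t, evE X h t) = ENNReal.ofReal (succA n h q (ones x0)) := by
  rw [measure_iUnion ?_ (meas_E hc.1 h), tsum_E hn hq0 hq1 hc]
  · have hB : ∀ x, evB X 0 x = {ω | X 0 ω = (x, Op.OW)} := by
      intro x
      ext ω
      simp [evB, Prod.ext_iff, and_comm]
    rw [Finset.sum_eq_single x0]
    · rw [hB, hinit, one_mul]
    · intro x _ hx
      rw [hB]
      have h0 : μ {ω | X 0 ω = (x0, Op.OW)}ᶜ = 0 := by
        exact (prob_compl_eq_zero_iff (measurable_event hc.1 0 {(x0, Op.OW)})).2 hinit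
      rw [measure_mono_null ?_ h0, zero_mul]
      intro ω hω hω'
      simp only [Set.mem_ofPred_eq] at hω hω'
      rw [hω] at hω'
      exact hx (Prod.ext_iff.1 hω').1
    · simp
  · intro s t hst
    refine Set.disjoint_left.2 fun ω h1 h2 => hst ?_
    have := switch_of_E X h s ω h1
    have := switch_of_E X h t ω h2
    omega

/-- Probability of climbing down to layer `n - h` in one OW phase on OneMax. -/
theorem ow_phase_prob (n : ℕ) (hn : 2 ≤ n) (p q : ℝ)
    (hp0 : 0 < p) (hp1 : p < 1) (hq0 : 0 < q) (hq1 : q < 1)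
    (k h : ℕ) (hk : k ≤ n) (hh : h ≤ n) (x0 : Point n) (hx0 : n - ones x0 = n - k)
    (Ω : Type) [MeasurableSpace Ω] (μ : Measure Ω) (X : ℕ → Ω → Point n × Op)
    (hprob : IsProbabilityMeasure μ) (hchain : IsMMAHH μ X (OneMax n) p q)
    (hinit : μ {ω | X 0 ω = (x0, Op.OW)} = 1) :
    (k ≤ h → μ {ω | n - h ≤ n - ones (X (switchTime X 1 ω) ω).1} = 1) ∧
    (h < k → μ {ω | n - h ≤ n - ones (X (switchTime X 1 ω) ω).1} =
      ENNReal.ofReal ((1 / (1 - q)) *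
        (Real.Gamma ((k : ℝ) + 1) * Real.Gamma ((n : ℝ) * q / (1 - q) + (h : ℝ) + 1)) /
        (Real.Gamma ((h : ℝ) + 1) * Real.Gamma ((n : ℝ) * q / (1 - q) + (k : ℝ) + 1)))) := by
  have hx : ones x0 = k := by
    have := ones_le x0
    omega
  have hev : {ω | n - h ≤ n - ones (X (switchTime X 1 ω) ω).1} =
      {ω | ones (X (switchTime X 1 ω) ω).1 ≤ h} := by
    ext ω
    have := ones_le (X (switchTime X 1 ω) ω).1
    simp only [Set.mem_ofPred_eq]
    omega
  have hP := ev_prob hn hq0 hq1 hchain h x0 hinit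
  have hsub : (⋃ t, evE X h t) ⊆ {ω | ones (X (switchTime X 1 ω) ω).1 ≤ h} := by
    intro ω hω
    obtain ⟨t, ht⟩ := Set.mem_iUnion.1 hω
    have h1 := switch_of_E X h t ω ht
    simp only [Set.mem_ofPred_eq]
    rw [h1]
    exact ht.2.2
  rw [hev]
  refine ⟨fun hkh => ?_, fun hkh => ?_⟩
  · refine le_antisymm prob_le_one ?_
    refine le_trans (le_of_eq ?_) (measure_mono hsub)
    rw [hP, hx, succA, if_pos hkh, ENNReal.ofReal_one]
  · have hS : succA n h q k = _ := if_neg (by omega)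
    rw [← hS, ← hx, ← hP]
    refine le_antisymm ?_ (measure_mono hsub)
    have h0 : μ {ω | X 0 ω = (x0, Op.OW)}ᶜ = 0 := by
      exact (prob_compl_eq_zero_iff (measurable_event hchain.1 0 {(x0, Op.OW)})).2 hinit
    rw [← add_zero (μ (⋃ t, evE X h t)), ← h0]
    refine le_trans (measure_mono ?_) (measure_union_le _ _)
    intro ω hω
    by_cases hi : X 0 ω = (x0, Op.OW)
    · left
      exact Set.mem_iUnion.2 (event_cover X h ω (by rw [hi]) (by rw [hi]; simp only; omega) hω)
    · right
      exact hi
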